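/- Let M be a spacelike surface in ℝ^{3,1} with a canonical normal null direction Z such that a ≠ 0. Then the Gauss map of M is G = Z^⊤ ∧ W, and its differential satisfies dG(Z^⊤) = β(Z^⊤) Z^⊥∧W + β(W) Z^⊤∧Z^⊥ and dG(W) = β(W) Z^⊥∧W + Z^⊤∧B(W,W). -/

import Mathlib

noncomputable section

/-- Points of the parameter domain of the surface chart. -/
abbrev Pt : Type := ℝ × ℝ

/-- Vectors of the Minkowski space `ℝ^{3,1}`. -/
abbrev E4 : Type := Fin 4 → ℝ

/-- The Minkowski bilinear form of signature `(+,+,+,-)` on `ℝ⁴`. -/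
def mink (v w : E4) : ℝ := v 0 * w 0 + v 1 * w 1 + v 2 * w 2 - v 3 * w 3

/-- Realization in `ℝ^{3,1}` of a coordinate vector field `X` along the immersion `ψ`. -/
def vecF (ψ : Pt → E4) (X : Pt → Pt) : Pt → E4 := fun p => fderiv ℝ ψ p (X p)

/-- Flat (ambient) derivative of an `ℝ⁴`-valued field along a coordinate vector field. -/
def Dflat (X : Pt → Pt) (V : Pt → E4) : Pt → E4 := fun p => fderiv ℝ V p (X p)

/-- Second fundamental form `B(X,Y) = ∇̄_X Y − ∇_X Y`. -/
def sff (ψ : Pt → E4) (conn : (Pt → Pt) → (Pt → Pt) → Pt → Pt) (X Y : Pt → Pt) : Pt → E4 :=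
  fun p => Dflat X (vecF ψ Y) p - vecF ψ (conn X Y) p

/-- `v` is tangent to the surface at `p`. -/
def isTangentV (ψ : Pt → E4) (p : Pt) (v : E4) : Prop := ∃ w : Pt, fderiv ℝ ψ p w = v

/-- `v` is normal to the surface at `p`. -/
def isNormalV (ψ : Pt → E4) (p : Pt) (v : E4) : Prop := ∀ w : Pt, mink v (fderiv ℝ ψ p w) = 0

/-- Lie bracket of coordinate vector fields on the chart. -/
def lieB (X Y : Pt → Pt) : Pt → Pt := fun p => fderiv ℝ Y p (X p) - fderiv ℝ X p (Y p)

/-- Curvature tensor `R(X,Y)V = ∇_Y∇_X V − ∇_X∇_Y V + ∇_{[X,Y]}V`. -/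
def curvR (conn : (Pt → Pt) → (Pt → Pt) → Pt → Pt) (X Y V : Pt → Pt) : Pt → Pt :=
  fun p => conn Y (conn X V) p - conn X (conn Y V) p + conn (lieB X Y) V p

/-- Normal curvature tensor `R^⊥(X,Y)ν = ∇⊥_Y∇⊥_X ν − ∇⊥_X∇⊥_Y ν + ∇⊥_{[X,Y]}ν`. -/
def curvRperp (nconn : (Pt → Pt) → (Pt → E4) → Pt → E4) (X Y : Pt → Pt) (ν : Pt → E4) :
    Pt → E4 :=
  fun p => nconn Y (nconn X ν) p - nconn X (nconn Y ν) p + nconn (lieB X Y) ν p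

/-- Determinant of four vectors of `ℝ⁴` (the volume form `e₁∧e₂∧e₃∧e₄ ↦ 1`). -/
def det4 (a b c d : E4) : ℝ := Matrix.det (Matrix.of ![a, b, c, d])

/-- A spacelike surface in `ℝ^{3,1}`, given by a chart `ψ : U → ℝ^{3,1}`, endowed with a
canonical normal null direction with respect to the constant unit spacelike vector `Z`,
together with all the associated geometric data: the Levi-Civita connection `conn`,
the normal connection `nconn`, the tangent part `Z^⊤` (coordinates `ZT`), the oriented
orthonormal completion `W` (coordinates `Wc`), the shape operator `shA = A_{Z^⊥}`,
the 1-form `β` with `B(X,Z^⊤) = β(X)Z^⊥`, and the lightlike normal field `W'` with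
`⟨Z^⊥,W'⟩ = 1`.  Each piece of data is characterized by its defining property. -/
structure CNND where
  U : Set Pt
  hUopen : IsOpen U
  ψ : Pt → E4
  hψ : ContDiffOn ℝ (⊤ : ℕ∞) ψ U
  himm : ∀ p ∈ U, ∀ v : Pt, fderiv ℝ ψ p v = 0 → v = 0
  hspacelike : ∀ p ∈ U, ∀ v : Pt, v ≠ 0 → 0 < mink (fderiv ℝ ψ p v) (fderiv ℝ ψ p v)
  /-- Levi-Civita connection of the induced metric, as the tangent part of the flat one. -/
  conn : (Pt → Pt) → (Pt → Pt) → Pt → Pt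
  hconn : ∀ X Y, ∀ p ∈ U, DifferentiableAt ℝ (vecF ψ Y) p → isNormalV ψ p (sff ψ conn X Y p)
  hconnSmooth : ∀ X Y, ContDiffOn ℝ (⊤ : ℕ∞) X U → ContDiffOn ℝ (⊤ : ℕ∞) Y U → ContDiffOn ℝ (⊤ : ℕ∞) (conn X Y) U
  /-- Normal connection: the normal part of the flat derivative of a normal field. -/
  nconn : (Pt → Pt) → (Pt → E4) → Pt → E4
  hnconn : ∀ X ν, ∀ p ∈ U, (∀ q ∈ U, isNormalV ψ q (ν q)) → DifferentiableAt ℝ ν p →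
    isNormalV ψ p (nconn X ν p) ∧ isTangentV ψ p (Dflat X ν p - nconn X ν p)
  hnconnSmooth : ∀ X ν, ContDiffOn ℝ (⊤ : ℕ∞) X U → (∀ q ∈ U, isNormalV ψ q (ν q)) →
    ContDiffOn ℝ (⊤ : ℕ∞) ν U → ContDiffOn ℝ (⊤ : ℕ∞) (nconn X ν) U
  /-- The parallel (constant) vector field `Z`, a unit spacelike vector. -/
  Z : E4
  hZunit : mink Z Z = 1
  /-- Coordinates of the tangent part `Z^⊤` of `Z`; `Z^⊥ = Z − Z^⊤` is normal. -/
  ZT : Pt → Pt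
  hZTsmooth : ContDiffOn ℝ (⊤ : ℕ∞) ZT U
  hZTtangentpart : ∀ p ∈ U, isNormalV ψ p (Z - fderiv ℝ ψ p (ZT p))
  /-- canonical normal null direction: `Z^⊥` is lightlike … -/
  hZperpNull : ∀ p ∈ U, mink (Z - fderiv ℝ ψ p (ZT p)) (Z - fderiv ℝ ψ p (ZT p)) = 0
  /-- … and nowhere zero. -/
  hZperpNe : ∀ p ∈ U, Z - fderiv ℝ ψ p (ZT p) ≠ 0
  /-- Coordinates of the unit tangent field `W` orthogonal to `Z^⊤`, positively oriented. -/
  Wc : Pt → Pt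
  hWsmooth : ContDiffOn ℝ (⊤ : ℕ∞) Wc U
  hWunit : ∀ p ∈ U, mink (fderiv ℝ ψ p (Wc p)) (fderiv ℝ ψ p (Wc p)) = 1
  hWorth : ∀ p ∈ U, mink (fderiv ℝ ψ p (ZT p)) (fderiv ℝ ψ p (Wc p)) = 0
  hWorient : ∀ p ∈ U, 0 < (ZT p).1 * (Wc p).2 - (ZT p).2 * (Wc p).1
  /-- The shape operator `A_{Z^⊥}`: `⟨A_{Z^⊥}X, Y⟩ = ⟨B(X,Y), Z^⊥⟩`. -/
  shA : (Pt → Pt) → Pt → Pt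
  hshA : ∀ X Y, ∀ p ∈ U, DifferentiableAt ℝ (vecF ψ Y) p →
    mink (fderiv ℝ ψ p (shA X p)) (fderiv ℝ ψ p (Y p)) =
      mink (sff ψ conn X Y p) (Z - fderiv ℝ ψ p (ZT p))
  /-- The 1-form `β` with `B(X, Z^⊤) = β(X) Z^⊥`. -/
  beta : Pt → Pt → ℝ
  hbeta : ∀ X, ∀ p ∈ U, sff ψ conn X ZT p = beta p (X p) • (Z - fderiv ℝ ψ p (ZT p))
  /-- The lightlike normal field `W'` with `⟨Z^⊥, W'⟩ = 1`, such that
  `(Z^⊤, W, (Z^⊥+W')/√2, (Z^⊥−W')/√2)` is a positively oriented orthonormal frame. -/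
  Wp : Pt → E4
  hWpNormal : ∀ p ∈ U, isNormalV ψ p (Wp p)
  hWpNull : ∀ p ∈ U, mink (Wp p) (Wp p) = 0
  hWpPair : ∀ p ∈ U, mink (Z - fderiv ℝ ψ p (ZT p)) (Wp p) = 1
  hWpOrient : ∀ p ∈ U, 0 < det4 (fderiv ℝ ψ p (ZT p)) (fderiv ℝ ψ p (Wc p))
    ((Real.sqrt 2)⁻¹ • ((Z - fderiv ℝ ψ p (ZT p)) + Wp p))
    ((Real.sqrt 2)⁻¹ • ((Z - fderiv ℝ ψ p (ZT p)) - Wp p))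

namespace CNND

variable (S : CNND)

/-- The normal part `Z^⊥` of `Z` along the surface. -/
def Zperp : Pt → E4 := fun p => S.Z - fderiv ℝ S.ψ p (S.ZT p)

/-- The second fundamental form of the surface. -/
def B : (Pt → Pt) → (Pt → Pt) → Pt → E4 := sff S.ψ S.conn

/-- The function `a = α(W) = ⟨B(W,W), Z^⊥⟩`. -/
def afun : Pt → ℝ := fun p => mink (S.B S.Wc S.Wc p) (S.Zperp p)

/-- The 1-form `α(X) = ⟨B(X,W), Z^⊥⟩`. -/
def alphaF (X : Pt → Pt) : Pt → ℝ := fun p => mink (S.B X S.Wc p) (S.Zperp p)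

/-- The mean curvature vector `H⃗ = (1/2)(B(Z^⊤,Z^⊤) + B(W,W))`. -/
def Hvec : Pt → E4 := fun p => (1 / 2 : ℝ) • (S.B S.ZT S.ZT p + S.B S.Wc S.Wc p)

/-- The Gauss curvature `K = ⟨R(Z^⊤,W)Z^⊤, W⟩`. -/
def Kfun : Pt → ℝ := fun p =>
  mink (fderiv ℝ S.ψ p (curvR S.conn S.ZT S.Wc S.ZT p)) (fderiv ℝ S.ψ p (S.Wc p))

/-- The normal curvature `K_N = ⟨R^⊥(Z^⊤,W)Z^⊥, W'⟩`. -/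
def KNfun : Pt → ℝ := fun p => mink (curvRperp S.nconn S.ZT S.Wc S.Zperp p) (S.Wp p)

end CNND

/-- The wedge `v ∧ w` of two vectors of `ℝ⁴`, as an antisymmetric matrix (bivector). -/
def wedge2 (v w : E4) : Fin 4 → Fin 4 → ℝ := fun i j => v i * w j - v j * w i

/-- The Gauss map `G = Z^⊤ ∧ W : M → Λ²ℝ^{3,1}`. -/
def CNND.Gmap (S : CNND) : Pt → Fin 4 → Fin 4 → ℝ :=
  fun p => wedge2 (fderiv ℝ S.ψ p (S.ZT p)) (fderiv ℝ S.ψ p (S.Wc p))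

/-- The signs of the Minkowski metric. -/
def epsM : Fin 4 → ℝ := fun i => if i = 3 then -1 else 1

/-- The induced (signature `(3,3)`) inner product on bivectors of `ℝ^{3,1}`:
`⟨v∧w, v'∧w'⟩ = ⟨v,v'⟩⟨w,w'⟩ − ⟨v,w'⟩⟨w,v'⟩`. -/
def binner (η η' : Fin 4 → Fin 4 → ℝ) : ℝ :=
  (1 / 2) * ∑ i : Fin 4, ∑ j : Fin 4, epsM i * epsM j * η i j * η' i j

/-- The wedge product `Λ²ℝ^{3,1} × Λ²ℝ^{3,1} → Λ⁴ℝ^{3,1} ≅ ℝ`, normalized so that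
`(v∧w)∧(v'∧w') = det(v,w,v',w')`. -/
def bwedge (η η' : Fin 4 → Fin 4 → ℝ) : ℝ :=
  (1 / 4) * ∑ σ : Equiv.Perm (Fin 4),
    ((Equiv.Perm.sign σ : ℤ) : ℝ) * η (σ 0) (σ 1) * η' (σ 2) (σ 3)

/-- The `ℂ`-bilinear form `H(η,η') = ⟨η,η'⟩ + i η∧η'` on bivectors, where `i = −⋆`. -/
def HformC (η η' : Fin 4 → Fin 4 → ℝ) : ℂ :=
  (binner η η' : ℝ) + (bwedge η η' : ℝ) * Complex.I

/-- The quadratic form `δ(u) = dG(u) ∧ dG(u)` whose zero directions are the asymptotic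
directions. -/
def CNND.deltaQ (S : CNND) (p : Pt) (u : Pt) : ℝ :=
  bwedge (fderiv ℝ S.Gmap p u) (fderiv ℝ S.Gmap p u)

lemma mink_comm (v w : E4) : mink v w = mink w v := by
  simp only [mink]; ring

lemma mink_add_left (u v w : E4) : mink (u + v) w = mink u w + mink v w := by
  simp only [mink, Pi.add_apply]; ring

lemma mink_sub_left (u v w : E4) : mink (u - v) w = mink u w - mink v w := by
  simp only [mink, Pi.sub_apply]; ring

lemma mink_smul_left (c : ℝ) (v w : E4) : mink (c • v) w = c * mink v w := by
  simp only [mink, Pi.smul_apply, smul_eq_mul]; ring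

/-- The Leibniz rule for the Minkowski form of a field with itself. -/
lemma mink_fderiv_self_eq_zero {V : Pt → E4} {p : Pt} {c : ℝ} (hV : DifferentiableAt ℝ V p)
    (hc : ∀ᶠ q in nhds p, mink (V q) (V q) = c) (x : Pt) : mink (fderiv ℝ V p x) (V p) = 0 := by
  have hi (i : Fin 4) := hasFDerivAt_pi'.1 hV.hasFDerivAt i
  have h := ((((hi 0).mul (hi 0)).add ((hi 1).mul (hi 1))).add ((hi 2).mul (hi 2))).sub
    ((hi 3).mul (hi 3))
  have h0 := (h.congr_of_eventuallyEq (f₁ := fun q => mink (V q) (V q))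
    (Filter.Eventually.of_forall fun _ => rfl)).unique
    ((hasFDerivAt_const c p).congr_of_eventuallyEq hc)
  have hx := DFunLike.congr_fun h0 x
  simp at hx
  simp only [mink]
  linarith

/-- The Leibniz rule for the wedge product of two fields. -/
lemma fderiv_wedge2 {V V' : Pt → E4} {p : Pt} (hV : DifferentiableAt ℝ V p)
    (hV' : DifferentiableAt ℝ V' p) (x : Pt) :
    fderiv ℝ (fun q => wedge2 (V q) (V' q)) p x =
      wedge2 (fderiv ℝ V p x) (V' p) + wedge2 (V p) (fderiv ℝ V' p x) := by
  have hi (i : Fin 4) := hasFDerivAt_pi'.1 hV.hasFDerivAt i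
  have hi' (i : Fin 4) := hasFDerivAt_pi'.1 hV'.hasFDerivAt i
  have hij (i j : Fin 4) := ((hi i).mul (hi' j)).sub ((hi j).mul (hi' i))
  have h : HasFDerivAt (fun q => wedge2 (V q) (V' q)) _ p :=
    hasFDerivAt_pi.2 fun i => hasFDerivAt_pi.2 fun j => hij i j
  rw [h.fderiv]
  ext i j
  simp [wedge2]
  ring

namespace CNND

variable (S : CNND) {p : Pt}

lemma differentiableAt_fderiv (hp : p ∈ S.U) : DifferentiableAt ℝ (fderiv ℝ S.ψ) p :=
  ((S.hψ.fderiv_of_isOpen S.hUopen (m := 1) (by norm_cast)).contDiffAt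
    (S.hUopen.mem_nhds hp)).differentiableAt (by norm_num)

lemma differentiableAt_of_contDiffOn {X : Pt → Pt} (hX : ContDiffOn ℝ (⊤ : ℕ∞) X S.U)
    (hp : p ∈ S.U) : DifferentiableAt ℝ X p :=
  (hX.contDiffAt (S.hUopen.mem_nhds hp)).differentiableAt (by norm_num)

lemma differentiableAt_vecF {X : Pt → Pt} (hX : DifferentiableAt ℝ X p) (hp : p ∈ S.U) :
    DifferentiableAt ℝ (vecF S.ψ X) p :=
  (S.differentiableAt_fderiv hp).clm_apply hX

lemma fderiv_vecF {X : Pt → Pt} (hX : DifferentiableAt ℝ X p) (hp : p ∈ S.U) (x : Pt) :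
    fderiv ℝ (vecF S.ψ X) p x =
      fderiv ℝ (fderiv ℝ S.ψ) p x (X p) + fderiv ℝ S.ψ p (fderiv ℝ X p x) := by
  have h := (S.differentiableAt_fderiv hp).hasFDerivAt.clm_apply hX.hasFDerivAt
  rw [show vecF S.ψ X = fun q => fderiv ℝ S.ψ q (X q) from rfl, h.fderiv]
  simp [add_comm]

/-- The second fundamental form is symmetric. -/
lemma B_comm {X Y : Pt → Pt} (hX : DifferentiableAt ℝ X p) (hY : DifferentiableAt ℝ Y p)
    (hp : p ∈ S.U) : S.B X Y p = S.B Y X p := by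
  have hsymm : fderiv ℝ (fderiv ℝ S.ψ) p (X p) (Y p) = fderiv ℝ (fderiv ℝ S.ψ) p (Y p) (X p) :=
    ((S.hψ.contDiffAt (S.hUopen.mem_nhds hp)).isSymmSndFDerivAt (by simp; norm_cast)).eq _ _
  have htan : S.B X Y p - S.B Y X p =
      fderiv ℝ S.ψ p (lieB X Y p - S.conn X Y p + S.conn Y X p) := by
    simp only [B, sff, Dflat, S.fderiv_vecF hX hp, S.fderiv_vecF hY hp, hsymm, lieB, vecF,
      map_sub, map_add]
    abel
  have hnXY := S.hconn X Y p hp (S.differentiableAt_vecF hY hp)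
  have hnYX := S.hconn Y X p hp (S.differentiableAt_vecF hX hp)
  set v := lieB X Y p - S.conn X Y p + S.conn Y X p
  have hv : v = 0 := by
    by_contra hv
    have hpos := S.hspacelike p hp v hv
    have hzero : mink (S.B X Y p - S.B Y X p) (fderiv ℝ S.ψ p v) = 0 := by
      rw [mink_sub_left]
      exact sub_eq_zero.2 ((hnXY v).trans (hnYX v).symm)
    rw [htan] at hzero
    exact hpos.ne' hzero
  rwa [hv, map_zero, sub_eq_zero] at htan

/-- `Z^⊤` is a unit field. -/
lemma mink_ZT_self (hp : p ∈ S.U) :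
    mink (fderiv ℝ S.ψ p (S.ZT p)) (fderiv ℝ S.ψ p (S.ZT p)) = 1 := by
  have h1 := S.hZTtangentpart p hp (S.ZT p)
  have h2 := S.hZperpNull p hp
  have h3 := S.hZunit
  simp only [mink, Pi.sub_apply] at *
  linarith

/-- Every tangent vector is a combination of `Z^⊤` and `W`. -/
lemma exists_eq_smul_add_smul (hp : p ∈ S.U) (x : Pt) :
    ∃ c d : ℝ, x = c • S.ZT p + d • S.Wc p := by
  have h := (S.hWorient p hp).ne'
  refine ⟨(x.1 * (S.Wc p).2 - x.2 * (S.Wc p).1) /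
      ((S.ZT p).1 * (S.Wc p).2 - (S.ZT p).2 * (S.Wc p).1),
    ((S.ZT p).1 * x.2 - (S.ZT p).2 * x.1) /
      ((S.ZT p).1 * (S.Wc p).2 - (S.ZT p).2 * (S.Wc p).1), ?_⟩
  ext <;> simp only [Prod.fst_add, Prod.snd_add, Prod.smul_fst, Prod.smul_snd, smul_eq_mul] <;>
    rw [div_mul_eq_mul_div, div_mul_eq_mul_div, ← add_div, eq_div_iff h] <;> ring

lemma exists_eq_smul_Wc (hp : p ∈ S.U) {x : Pt}
    (hx : mink (fderiv ℝ S.ψ p x) (fderiv ℝ S.ψ p (S.ZT p)) = 0) :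
    ∃ d : ℝ, fderiv ℝ S.ψ p x = d • fderiv ℝ S.ψ p (S.Wc p) := by
  obtain ⟨c, d, rfl⟩ := S.exists_eq_smul_add_smul hp x
  rw [map_add, map_smul, map_smul, mink_add_left, mink_smul_left, mink_smul_left,
    S.mink_ZT_self hp, mink_comm, S.hWorth p hp] at hx
  exact ⟨d, by simp [show c = 0 by linarith]⟩

lemma exists_eq_smul_ZT (hp : p ∈ S.U) {x : Pt}
    (hx : mink (fderiv ℝ S.ψ p x) (fderiv ℝ S.ψ p (S.Wc p)) = 0) :
    ∃ c : ℝ, fderiv ℝ S.ψ p x = c • fderiv ℝ S.ψ p (S.ZT p) := by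
  obtain ⟨c, d, rfl⟩ := S.exists_eq_smul_add_smul hp x
  rw [map_add, map_smul, map_smul, mink_add_left, mink_smul_left, mink_smul_left,
    S.hWunit p hp, S.hWorth p hp] at hx
  exact ⟨c, by simp [show d = 0 by linarith]⟩

/-- The covariant derivative of a tangent field of constant length is orthogonal to it. -/
lemma mink_conn_self {X Y : Pt → Pt} {c : ℝ} (hY : DifferentiableAt ℝ Y p) (hp : p ∈ S.U)
    (hc : ∀ q ∈ S.U, mink (fderiv ℝ S.ψ q (Y q)) (fderiv ℝ S.ψ q (Y q)) = c) :
    mink (fderiv ℝ S.ψ p (S.conn X Y p)) (fderiv ℝ S.ψ p (Y p)) = 0 := by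
  have hd := S.differentiableAt_vecF hY hp
  have hn := S.hconn X Y p hp hd (Y p)
  have h := mink_fderiv_self_eq_zero hd
    (Filter.eventually_of_mem (S.hUopen.mem_nhds hp) hc) (X p)
  rw [sff, mink_sub_left] at hn
  simp only [Dflat, vecF] at hn h
  linarith

/-- `dG(X) = B(X, Z^⊤) ∧ W + Z^⊤ ∧ B(X, W)`. -/
lemma fderiv_Gmap (X : Pt → Pt) (hp : p ∈ S.U) :
    fderiv ℝ S.Gmap p (X p) =
      wedge2 (S.B X S.ZT p) (fderiv ℝ S.ψ p (S.Wc p)) +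
        wedge2 (fderiv ℝ S.ψ p (S.ZT p)) (S.B X S.Wc p) := by
  have hZ := S.differentiableAt_of_contDiffOn S.hZTsmooth hp
  have hW := S.differentiableAt_of_contDiffOn S.hWsmooth hp
  obtain ⟨d, hd⟩ := S.exists_eq_smul_Wc hp
    (S.mink_conn_self (X := X) hZ hp fun q hq => S.mink_ZT_self hq)
  obtain ⟨c, hc⟩ := S.exists_eq_smul_ZT hp (S.mink_conn_self (X := X) hW hp S.hWunit)
  have h := fderiv_wedge2 (S.differentiableAt_vecF hZ hp) (S.differentiableAt_vecF hW hp) (X p)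
  rw [show S.Gmap = fun q => wedge2 (vecF S.ψ S.ZT q) (vecF S.ψ S.Wc q) from rfl, h]
  ext i j
  simp only [B, sff, Dflat, wedge2, Pi.add_apply, Pi.sub_apply]
  simp only [vecF, hc, hd, Pi.smul_apply, smul_eq_mul]
  ring

end CNND

/-- If `a ≠ 0`, the Gauss map of `M` is `G = Z^⊤ ∧ W`, and its differential
satisfies `dG(Z^⊤) = β(Z^⊤) Z^⊥∧W + β(W) Z^⊤∧Z^⊥` and
`dG(W) = β(W) Z^⊥∧W + Z^⊤∧B(W,W)`. -/
theorem cnnd_gauss_map_differential (S : CNND) (ha : ∀ p ∈ S.U, S.afun p ≠ 0)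
    (hG : ∀ p ∈ S.U, DifferentiableAt ℝ S.Gmap p) :
    ∀ p ∈ S.U,
      S.Gmap p = wedge2 (fderiv ℝ S.ψ p (S.ZT p)) (fderiv ℝ S.ψ p (S.Wc p)) ∧
      fderiv ℝ S.Gmap p (S.ZT p) =
        S.beta p (S.ZT p) • wedge2 (S.Zperp p) (fderiv ℝ S.ψ p (S.Wc p)) +
          S.beta p (S.Wc p) • wedge2 (fderiv ℝ S.ψ p (S.ZT p)) (S.Zperp p) ∧
      fderiv ℝ S.Gmap p (S.Wc p) =
        S.beta p (S.Wc p) • wedge2 (S.Zperp p) (fderiv ℝ S.ψ p (S.Wc p)) +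
          wedge2 (fderiv ℝ S.ψ p (S.ZT p)) (S.B S.Wc S.Wc p) := by
  intro p hp
  have hZ := S.differentiableAt_of_contDiffOn S.hZTsmooth hp
  have hW := S.differentiableAt_of_contDiffOn S.hWsmooth hp
  have hbeta (X : Pt → Pt) : S.B X S.ZT p = S.beta p (X p) • S.Zperp p := S.hbeta X p hp
  refine ⟨rfl, ?_, ?_⟩
  · rw [S.fderiv_Gmap S.ZT hp, S.B_comm hZ hW hp, hbeta, hbeta]
    ext i j
    simp only [wedge2, Pi.add_apply, Pi.smul_apply, smul_eq_mul]
    ring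
  · rw [S.fderiv_Gmap S.Wc hp, hbeta]
    ext i j
    simp only [wedge2, Pi.add_apply, Pi.smul_apply, smul_eq_mul]
    ring

end
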